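/- Let Z and V be real Banach spaces with a continuous dense embedding j : Z → V, let ρ > 0, and let R : Z → [0,∞] be a proper, positively 1-homogeneous, convex, lower semicontinuous function. Define ψ_ρ := R + χ_ρ : Z → [0,∞]. Then for every ζ ∈ Z*: ψ_ρ*(ζ) = ρ · dist_{V*}(ζ, ∂R(0)); in particular ψ_ρ*(ζ) = ∞ if there exists no ξ ∈ ∂R(0) such that ζ − ξ belongs to V*. -/

import Mathlib

open Filter
open scoped ENNReal

noncomputable section

/-- The subdifferential of an `[0,∞]`-valued convex function at a point. -/
def Subdiff {Z : Type*} [NormedAddCommGroup Z] [NormedSpace ℝ Z]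
    (f : Z → ℝ≥0∞) (v : Z) : Set (Z →L[ℝ] ℝ) :=
  {ξ | ∀ w : Z, (f v : EReal) + ((ξ (w - v) : ℝ) : EReal) ≤ (f w : EReal)}

/-- `dist_{V*}(ζ, A) = inf { ‖η‖_{V*} : η ∈ V*, ζ - j*η ∈ A }`, with `inf ∅ = ∞`. -/
def DistVStar {Z V : Type*} [NormedAddCommGroup Z] [NormedSpace ℝ Z]
    [NormedAddCommGroup V] [NormedSpace ℝ V] (j : Z →L[ℝ] V)
    (ζ : Z →L[ℝ] ℝ) (A : Set (Z →L[ℝ] ℝ)) : ℝ≥0∞ :=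
  ⨅ η ∈ {η : V →L[ℝ] ℝ | ζ - η.comp j ∈ A}, (‖η‖₊ : ℝ≥0∞)

/-- Convexity of an `[0,∞]`-valued function. -/
def ConvexOnENN {Z : Type*} [NormedAddCommGroup Z] [NormedSpace ℝ Z]
    (f : Z → ℝ≥0∞) : Prop :=
  ∀ x y : Z, ∀ a b : ℝ, 0 ≤ a → 0 ≤ b → a + b = 1 →
    f (a • x + b • y) ≤ ENNReal.ofReal a * f x + ENNReal.ofReal b * f y

/-- Positive 1-homogeneity of an `[0,∞]`-valued function. -/
def PosOneHom {Z : Type*} [NormedAddCommGroup Z] [NormedSpace ℝ Z]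
    (f : Z → ℝ≥0∞) : Prop :=
  f 0 = 0 ∧ ∀ c : ℝ, 0 < c → ∀ u : Z, f (c • u) = ENNReal.ofReal c * f u

/-- The convex (Legendre–Fenchel) conjugate of an `[0,∞]`-valued function, with
values in `[-∞,∞]`: `f*(ξ) = sup_z (⟨ξ, z⟩ - f z)`. -/
def Conj {Z : Type*} [NormedAddCommGroup Z] [NormedSpace ℝ Z]
    (f : Z → ℝ≥0∞) (ξ : Z →L[ℝ] ℝ) : EReal :=
  ⨆ z : Z, ((ξ z : ℝ) : EReal) - (f z : EReal)

/-- The indicator function `χ_ρ` of the set `{v : ‖j v‖_V ≤ ρ}`, as a map to `[0,∞]`. -/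
def chiRho {Z V : Type*} [NormedAddCommGroup Z] [NormedSpace ℝ Z]
    [NormedAddCommGroup V] [NormedSpace ℝ V] (j : Z →L[ℝ] V) (ρ : ℝ) (v : Z) : ℝ≥0∞ :=
  if ‖j v‖ ≤ ρ then 0 else ⊤

/-- A consequence of the Hahn–Banach theorem: a sublinear function `g` on a convex cone `S ⊆ Z` with
`-c‖j z‖ ≤ g z` dominates `-j*η` on `S` for some `η ∈ V*` with `‖η‖ ≤ c`. -/
theorem exists_dual_norm_le_of_sublinear
    {Z V : Type*} [NormedAddCommGroup Z] [NormedSpace ℝ Z]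
    [NormedAddCommGroup V] [NormedSpace ℝ V] (j : Z →L[ℝ] V) {c : ℝ} (hc : 0 ≤ c)
    (S : Set Z) (g : Z → ℝ) (h0 : (0 : Z) ∈ S) (hg0 : g 0 = 0)
    (hadd : ∀ x ∈ S, ∀ y ∈ S, x + y ∈ S ∧ g (x + y) ≤ g x + g y)
    (hsmul : ∀ a : ℝ, 0 < a → ∀ x ∈ S, a • x ∈ S ∧ g (a • x) = a * g x)
    (hbound : ∀ z ∈ S, -(c * ‖j z‖) ≤ g z) :
    ∃ η : V →L[ℝ] ℝ, ‖η‖ ≤ c ∧ ∀ z ∈ S, -η (j z) ≤ g z := by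
  let N : V → ℝ := fun y => ⨅ z : S, (c * ‖y + j z‖ + g z)
  have : Nonempty S := ⟨⟨0, h0⟩⟩
  have hbdd (y : V) : BddBelow (Set.range fun z : S => c * ‖y + j z‖ + g z) := by
    refine ⟨-(c * ‖y‖), ?_⟩
    rintro _ ⟨z, rfl⟩
    have hnorm : ‖j z‖ ≤ ‖y + j z‖ + ‖y‖ := by
      simpa using norm_sub_le (y + j z) y
    have := mul_le_mul_of_nonneg_left hnorm hc
    have := hbound z z.2
    dsimp only
    linarith
  have hN_le (y : V) {z : Z} (hz : z ∈ S) : N y ≤ c * ‖y + j z‖ + g z :=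
    ciInf_le (hbdd y) ⟨z, hz⟩
  have hN_smul_le (a : ℝ) (ha : 0 < a) (y : V) : N (a • y) ≤ a * N y := by
    rw [← div_le_iff₀' ha]
    refine le_ciInf fun z => ?_
    rw [div_le_iff₀' ha]
    obtain ⟨hz, hgz⟩ := hsmul a ha z z.2
    refine (hN_le _ hz).trans_eq ?_
    rw [map_smul, ← smul_add, norm_smul, Real.norm_of_nonneg ha.le, hgz]
    ring
  have hN_smul (a : ℝ) (ha : 0 < a) (y : V) : N (a • y) = a * N y := by
    refine le_antisymm (hN_smul_le a ha y) ?_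
    have := hN_smul_le a⁻¹ (inv_pos.2 ha) (a • y)
    rwa [inv_smul_smul₀ ha.ne', inv_mul_eq_div, le_div_iff₀' ha] at this
  have hN_add (x y : V) : N (x + y) ≤ N x + N y := by
    refine le_ciInf_add_ciInf fun z w => ?_
    obtain ⟨hzw, hgzw⟩ := hadd z z.2 w w.2
    have hnorm : ‖x + y + j (z + w)‖ ≤ ‖x + j z‖ + ‖y + j w‖ := by
      rw [map_add, add_add_add_comm]
      exact norm_add_le _ _
    have := mul_le_mul_of_nonneg_left hnorm hc
    have := hN_le (x + y) hzw
    linarith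
  have hN_zero : 0 ≤ N 0 := by
    refine le_ciInf fun z => ?_
    have := hbound z z.2
    rw [zero_add]
    linarith
  obtain ⟨f, -, hf⟩ := exists_extension_of_le_sublinear (⊥ : V →ₗ.[ℝ] ℝ) N hN_smul hN_add
    fun x => by
      have hx : x = 0 := Subtype.ext ((Submodule.mem_bot ℝ).1 x.2)
      rw [hx, LinearPMap.map_zero]
      exact hN_zero
  have hf_le (y : V) : f y ≤ c * ‖y‖ := by
    simpa [hg0] using (hf y).trans (hN_le y h0)
  have hf_norm (y : V) : ‖f y‖ ≤ c * ‖y‖ := by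
    rw [Real.norm_eq_abs, abs_le']
    exact ⟨hf_le y, by simpa using hf_le (-y)⟩
  refine ⟨f.mkContinuous c hf_norm, f.mkContinuous_norm_le hc hf_norm, fun z hz => ?_⟩
  simpa using (hf (-j z)).trans (hN_le _ hz)

theorem mem_subdiff_zero_iff {Z : Type*} [NormedAddCommGroup Z] [NormedSpace ℝ Z]
    {R : Z → ℝ≥0∞} (hR0 : R 0 = 0) (ξ : Z →L[ℝ] ℝ) :
    ξ ∈ Subdiff R 0 ↔ ∀ z, R z ≠ ⊤ → ξ z ≤ (R z).toReal := by
  simp only [Subdiff, Set.mem_ofPred_eq, hR0, EReal.coe_ennreal_zero, zero_add, sub_zero]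
  refine forall_congr' fun z => ?_
  by_cases hz : R z = ⊤
  · simp [hz]
  · rw [← EReal.coe_ennreal_toReal hz, EReal.coe_le_coe_iff]
    simp [hz]

theorem conj_add_chiRho_le_coe_iff {Z V : Type*} [NormedAddCommGroup Z] [NormedSpace ℝ Z]
    [NormedAddCommGroup V] [NormedSpace ℝ V] (j : Z →L[ℝ] V) (ρ : ℝ) (R : Z → ℝ≥0∞)
    (ζ : Z →L[ℝ] ℝ) (M : ℝ) :
    Conj (fun v => R v + chiRho j ρ v) ζ ≤ (M : EReal) ↔
      ∀ z, ‖j z‖ ≤ ρ → R z ≠ ⊤ → ζ z - (R z).toReal ≤ M := by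
  rw [Conj, iSup_le_iff]
  refine forall_congr' fun z => ?_
  by_cases hj : ‖j z‖ ≤ ρ
  · by_cases hz : R z = ⊤
    · simp [hz]
    · simp only [chiRho, hj, if_true, add_zero]
      rw [← EReal.coe_ennreal_toReal hz, ← EReal.coe_sub, EReal.coe_le_coe_iff]
      simp [hz]
  · simp [chiRho, hj]

theorem conj_add_chiRho_nonneg {Z V : Type*} [NormedAddCommGroup Z] [NormedSpace ℝ Z]
    [NormedAddCommGroup V] [NormedSpace ℝ V] (j : Z →L[ℝ] V) {ρ : ℝ} (hρ : 0 ≤ ρ)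
    {R : Z → ℝ≥0∞} (hR0 : R 0 = 0) (ζ : Z →L[ℝ] ℝ) :
    0 ≤ Conj (fun v => R v + chiRho j ρ v) ζ :=
  le_iSup_of_le 0 (by simp [chiRho, hρ, hR0])

theorem PosOneHom.add_le {Z : Type*} [NormedAddCommGroup Z] [NormedSpace ℝ Z]
    {R : Z → ℝ≥0∞} (hRhom : PosOneHom R) (hRconv : ConvexOnENN R) (x y : Z) :
    R (x + y) ≤ R x + R y := by
  have h := hRconv ((2 : ℝ) • x) ((2 : ℝ) • y) 2⁻¹ 2⁻¹ (by norm_num) (by norm_num) (by norm_num)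
  rw [inv_smul_smul₀ two_ne_zero, inv_smul_smul₀ two_ne_zero, hRhom.2 2 two_pos,
    hRhom.2 2 two_pos, ← mul_assoc, ← mul_assoc,
    ← ENNReal.ofReal_mul (by norm_num : (0 : ℝ) ≤ 2⁻¹)] at h
  simpa using h

theorem conj_add_chiRho_le_of_mem_subdiff {Z V : Type*} [NormedAddCommGroup Z] [NormedSpace ℝ Z]
    [NormedAddCommGroup V] [NormedSpace ℝ V] (j : Z →L[ℝ] V) (ρ : ℝ) {R : Z → ℝ≥0∞}
    (hR0 : R 0 = 0) {ζ : Z →L[ℝ] ℝ} {η : V →L[ℝ] ℝ} (hη : ζ - η.comp j ∈ Subdiff R 0) :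
    Conj (fun v => R v + chiRho j ρ v) ζ ≤ ((ρ * ‖η‖ : ℝ) : EReal) := by
  rw [conj_add_chiRho_le_coe_iff]
  intro z hz hRz
  have hsub : ζ z - η (j z) ≤ (R z).toReal := (mem_subdiff_zero_iff hR0 _).1 hη z hRz
  have hop : η (j z) ≤ ‖η‖ * ‖j z‖ := (le_abs_self _).trans (η.le_opNorm (j z))
  have := mul_le_mul_of_nonneg_left hz (norm_nonneg η)
  linarith

theorem exists_mem_subdiff_of_conj_add_chiRho_le {Z V : Type*}
    [NormedAddCommGroup Z] [NormedSpace ℝ Z] [NormedAddCommGroup V] [NormedSpace ℝ V]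
    (j : Z →L[ℝ] V) {ρ : ℝ} (hρ : 0 < ρ) {R : Z → ℝ≥0∞} (hRhom : PosOneHom R)
    (hRconv : ConvexOnENN R) {ζ : Z →L[ℝ] ℝ} {M : ℝ} (hM : 0 ≤ M)
    (h : Conj (fun v => R v + chiRho j ρ v) ζ ≤ (M : EReal)) :
    ∃ η : V →L[ℝ] ℝ, ‖η‖ ≤ M / ρ ∧ ζ - η.comp j ∈ Subdiff R 0 := by
  rw [conj_add_chiRho_le_coe_iff] at h
  have hsmul (a : ℝ) (ha : 0 < a) (z : Z) (hz : R z ≠ ⊤) :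
      R (a • z) ≠ ⊤ ∧ (R (a • z)).toReal - ζ (a • z) = a * ((R z).toReal - ζ z) := by
    rw [hRhom.2 a ha]
    refine ⟨ENNReal.mul_ne_top ENNReal.ofReal_ne_top hz, ?_⟩
    rw [ENNReal.toReal_mul, ENNReal.toReal_ofReal ha.le, map_smul, smul_eq_mul]
    ring
  obtain ⟨η, hη, hle⟩ := exists_dual_norm_le_of_sublinear j (div_nonneg hM hρ.le)
    {z | R z ≠ ⊤} (fun z => (R z).toReal - ζ z) (by simp [hRhom.1]) (by simp [hRhom.1])
    (fun x hx y hy => by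
      have hxy : R x + R y ≠ ⊤ := ENNReal.add_ne_top.2 ⟨hx, hy⟩
      have hle := hRhom.add_le hRconv x y
      refine ⟨ne_top_of_le_ne_top hxy hle, ?_⟩
      have := ENNReal.toReal_mono hxy hle
      rw [ENNReal.toReal_add hx hy] at this
      rw [map_add]
      linarith)
    hsmul
    (fun z hz => by
      rcases (norm_nonneg (j z)).eq_or_lt with hj | hj
      · rw [← hj, mul_zero, neg_zero]
        by_contra! hneg
        have ha : 0 < (M + 1) / (ζ z - (R z).toReal) := by
          apply div_pos <;> linarith
        obtain ⟨hfin, heq⟩ := hsmul _ ha z hz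
        have := h _ (by rw [map_smul, norm_smul, ← hj, mul_zero]; exact hρ.le) hfin
        have hcancel := div_mul_cancel₀ (M + 1) (show ζ z - (R z).toReal ≠ 0 by linarith)
        linarith
      · have ha : 0 < ρ / ‖j z‖ := div_pos hρ hj
        obtain ⟨hfin, heq⟩ := hsmul _ ha z hz
        have := h _ (by
          rw [map_smul, norm_smul, Real.norm_of_nonneg ha.le, div_mul_cancel₀ _ hj.ne']) hfin
        have hbound : ρ / ‖j z‖ * -((R z).toReal - ζ z) ≤ M := by linarith
        rw [div_mul_eq_mul_div, div_le_iff₀ hj, ← le_div_iff₀' hρ] at hbound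
        rw [div_mul_eq_mul_div]
        linarith)
  refine ⟨η, hη, (mem_subdiff_zero_iff hRhom.1 _).2 fun z hz => ?_⟩
  have : -η (j z) ≤ (R z).toReal - ζ z := hle z hz
  change ζ z - η (j z) ≤ _
  linarith

/-- **Conjugate of `ψ_ρ = R + χ_ρ`.** For real Banach spaces `Z`, `V` with a continuous
dense embedding `j : Z → V`, `ρ > 0` and `R : Z → [0,∞]` proper, positively 1-homogeneous,
convex and lower semicontinuous, one has `ψ_ρ*(ζ) = ρ · dist_{V*}(ζ, ∂R(0))` for every
`ζ ∈ Z*`; in particular `ψ_ρ*(ζ) = ∞` if there is no `ξ ∈ ∂R(0)` with `ζ - ξ ∈ V*`. -/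
theorem statement1
    {Z V : Type*} [NormedAddCommGroup Z] [NormedSpace ℝ Z] [CompleteSpace Z]
    [NormedAddCommGroup V] [NormedSpace ℝ V] [CompleteSpace V]
    (j : Z →L[ℝ] V) (hjinj : Function.Injective j) (hjdense : DenseRange j)
    (ρ : ℝ) (hρ : 0 < ρ)
    (R : Z → ℝ≥0∞) (hRproper : ∃ z, R z ≠ ⊤) (hRhom : PosOneHom R)
    (hRconv : ConvexOnENN R) (hRlsc : LowerSemicontinuous R) :
    ∀ ζ : Z →L[ℝ] ℝ,
      Conj (fun v => R v + chiRho j ρ v) ζ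
        = ((ENNReal.ofReal ρ * DistVStar j ζ (Subdiff R 0) : ℝ≥0∞) : EReal) ∧
      ((∀ η : V →L[ℝ] ℝ, ζ - η.comp j ∉ Subdiff R 0) →
        Conj (fun v => R v + chiRho j ρ v) ζ = ⊤) := by
  intro ζ
  have hconj : Conj (fun v => R v + chiRho j ρ v) ζ
      = ((ENNReal.ofReal ρ * DistVStar j ζ (Subdiff R 0) : ℝ≥0∞) : EReal) := by
    obtain ⟨C, hC⟩ : ∃ C : ℝ≥0∞, (C : EReal) = Conj (fun v => R v + chiRho j ρ v) ζ :=
      ⟨_, EReal.coe_toENNReal (conj_add_chiRho_nonneg j hρ.le hRhom.1 ζ)⟩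
    rw [← hC, EReal.coe_ennreal_eq_coe_ennreal_iff]
    have hρ0 : ENNReal.ofReal ρ ≠ 0 := by simpa using hρ
    apply le_antisymm
    · rw [mul_comm, ← ENNReal.div_le_iff hρ0 ENNReal.ofReal_ne_top]
      refine le_iInf₂ fun η hη => ?_
      rw [ENNReal.div_le_iff hρ0 ENNReal.ofReal_ne_top, ← EReal.coe_ennreal_le_coe_ennreal_iff, hC]
      refine (conj_add_chiRho_le_of_mem_subdiff j ρ hRhom.1 hη).trans_eq ?_
      rw [← enorm_eq_nnnorm, ← ofReal_norm, ← ENNReal.ofReal_mul (norm_nonneg η),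
        EReal.coe_ennreal_ofReal, max_eq_left (by positivity), mul_comm]
    · by_cases htop : C = ⊤
      · simp [htop]
      rw [← EReal.coe_ennreal_toReal htop] at hC
      obtain ⟨η, hη, hmem⟩ := exists_mem_subdiff_of_conj_add_chiRho_le j hρ hRhom hRconv
        ENNReal.toReal_nonneg hC.ge
      rw [mul_comm, ← ENNReal.le_div_iff_mul_le (.inl hρ0) (.inl ENNReal.ofReal_ne_top)]
      refine (iInf₂_le η hmem).trans ?_
      rw [← enorm_eq_nnnorm, ← ofReal_norm, ← ENNReal.ofReal_toReal htop,
        ← ENNReal.ofReal_div_of_pos hρ]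
      exact ENNReal.ofReal_le_ofReal hη
  refine ⟨hconj, fun hnone => ?_⟩
  rw [hconj]
  have hdist : DistVStar j ζ (Subdiff R 0) = ⊤ := by
    simp [DistVStar, hnone]
  rw [hdist, ENNReal.mul_top (by simpa using hρ), EReal.coe_ennreal_top]
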